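/- Let G be an abelian group with neutral element e and let g₁,g₂,g₁',g₂' ∈ G. The gradings Γ¹(G;g₁,g₂) and Γ¹(G;g₁',g₂') on K₃ × K₃ are isomorphic if and only if the sets {g₁, g₁⁻¹, g₂, g₂⁻¹} and {g₁', (g₁')⁻¹, g₂', (g₂')⁻¹} coincide. -/

import Mathlib

open scoped TensorProduct
noncomputable section
namespace Kac

/-! ### Superalgebra isomorphisms and automorphisms -/

@[ext]
structure SuperIso (S A B : Type) [CommRing S]
    [AddCommGroup A] [Module S A] [Mul A]
    [AddCommGroup B] [Module S B] [Mul B]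
    (evA odA : Submodule S A) (evB odB : Submodule S B) : Type where
  e : A ≃ₗ[S] B
  map_mul' : ∀ x y : A, e (x * y) = e x * e y
  map_even : evA.map e.toLinearMap = evB
  map_odd : odA.map e.toLinearMap = odB

abbrev SuperAut (S A : Type) [CommRing S] [AddCommGroup A] [Module S A] [Mul A]
    (ev od : Submodule S A) := SuperIso S A A ev od ev od

namespace SuperAut

variable {S A : Type} [CommRing S] [AddCommGroup A] [Module S A] [Mul A]
variable {ev od : Submodule S A}

private lemma map_symm {f : A ≃ₗ[S] A} {p : Submodule S A}
    (h : p.map f.toLinearMap = p) : p.map f.symm.toLinearMap = p := by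
  have h2 : f.symm.toLinearMap.comp f.toLinearMap = LinearMap.id := by
    ext x; simp
  calc p.map f.symm.toLinearMap
      = (p.map f.toLinearMap).map f.symm.toLinearMap := by rw [h]
    _ = p.map (f.symm.toLinearMap.comp f.toLinearMap) := by
        rw [Submodule.map_comp]
    _ = p := by rw [h2, Submodule.map_id]

instance : Group (SuperAut S A ev od) where
  one := ⟨LinearEquiv.refl S A, fun _ _ => rfl, Submodule.map_id _, Submodule.map_id _⟩
  mul f g := ⟨g.e.trans f.e,
    fun x y => by simp [LinearEquiv.trans_apply, g.map_mul', f.map_mul'],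
    by rw [LinearEquiv.coe_trans, Submodule.map_comp, g.map_even, f.map_even],
    by rw [LinearEquiv.coe_trans, Submodule.map_comp, g.map_odd, f.map_odd]⟩
  inv f := ⟨f.e.symm,
    fun x y => f.e.injective <| by simp [f.map_mul'],
    map_symm f.map_even, map_symm f.map_odd⟩
  mul_assoc f g h := by apply SuperIso.ext; apply LinearEquiv.ext; intro x; rfl
  one_mul f := by apply SuperIso.ext; apply LinearEquiv.ext; intro x; rfl
  mul_one f := by apply SuperIso.ext; apply LinearEquiv.ext; intro x; rfl
  inv_mul_cancel f := by
    apply SuperIso.ext; apply LinearEquiv.ext; intro x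
    exact f.e.symm_apply_apply x

end SuperAut

/-- The predicate that a pair of submodules `ev`, `od` makes a non-unital
(possibly non-associative) algebra `B` into a superalgebra. -/
def IsSuperalgebra (S B : Type) [CommRing S] [NonUnitalNonAssocRing B] [Module S B]
    (ev od : Submodule S B) : Prop :=
  ev ⊔ od = ⊤ ∧ ev ⊓ od = ⊥ ∧
  (∀ x ∈ ev, ∀ y ∈ ev, x * y ∈ ev) ∧ (∀ x ∈ ev, ∀ y ∈ od, x * y ∈ od) ∧
  (∀ x ∈ od, ∀ y ∈ ev, x * y ∈ od) ∧ (∀ x ∈ od, ∀ y ∈ od, x * y ∈ ev)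

/-! ### Submodules given by vanishing of coordinates -/

def stdSub (S R : Type) [Semiring S] [AddCommGroup R] [Module S R] (n : ℕ)
    (s : Set (Fin n)) : Submodule S (Fin n → R) where
  carrier := {x | ∀ i, i ∉ s → x i = 0}
  add_mem' := fun {a b} ha hb i hi => by
    simp [Pi.add_apply, ha i hi, hb i hi]
  zero_mem' := fun i _ => rfl
  smul_mem' := fun c x hx i hi => by
    simp [Pi.smul_apply, hx i hi]

/-! ### Gradings by abelian groups -/

section Gradings

variable {G H S A : Type} [CommGroup G] [CommGroup H] [CommRing S]
  [AddCommGroup A] [Module S A] [Mul A]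

/-- `comp` is a `G`-grading of the superalgebra `(A, ev, od)`. -/
def IsSuperGrading (ev od : Submodule S A) (comp : G → Submodule S A) : Prop :=
  (letI := Classical.decEq G; DirectSum.IsInternal comp) ∧
  (∀ (g h : G) (x y : A), x ∈ comp g → y ∈ comp h → x * y ∈ comp (g * h)) ∧
  (∀ g, comp g = (comp g ⊓ ev) ⊔ (comp g ⊓ od))

/-- The grading with homogeneous elements `w i` of degrees `d i`. -/
def gradingOf (S : Type) {A G : Type} [CommRing S] [AddCommGroup A] [Module S A]
    [CommGroup G] {n : ℕ} (w : Fin n → A) (d : Fin n → G) : G → Submodule S A :=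
  fun g => Submodule.span S (w '' {i | d i = g})

/-- Isomorphism of two `G`-gradings on a superalgebra. -/
def GradIso (ev od : Submodule S A) (comp comp' : G → Submodule S A) : Prop :=
  ∃ φ : SuperAut S A ev od, ∀ g, (comp g).map φ.e.toLinearMap = comp' g

/-- `Δ` refines `Γ`. -/
def Refines (Δ : H → Submodule S A) (Γ : G → Submodule S A) : Prop :=
  ∀ h, Δ h ≠ ⊥ → ∃ g, Δ h ≤ Γ g

/-- Equivalence of a `G`-grading and an `H`-grading on a superalgebra. -/
def GradEquiv (ev od : Submodule S A) (Γ : G → Submodule S A)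
    (Δ : H → Submodule S A) : Prop :=
  ∃ φ : SuperAut S A ev od, ∃ α : {g : G // Γ g ≠ ⊥} → {h : H // Δ h ≠ ⊥},
    Function.Bijective α ∧
    ∀ g : {g : G // Γ g ≠ ⊥}, (Γ g.1).map φ.e.toLinearMap = Δ (α g).1

/-- A grading is fine if any grading refining it has the same nonzero
homogeneous components. -/
def IsFine (ev od : Submodule S A) (Γ : G → Submodule S A) : Prop :=
  ∀ (H : Type) (_ : CommGroup H) (Δ : H → Submodule S A),
    IsSuperGrading ev od Δ → Refines Δ Γ →
      {p : Submodule S A | p ≠ ⊥ ∧ ∃ h, Δ h = p} =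
      {p : Submodule S A | p ≠ ⊥ ∧ ∃ g, Γ g = p}

end Gradings

/-! ### SL₂ and the semidirect product with C₂ -/

abbrev SL2 (R : Type) [CommRing R] := Matrix.SpecialLinearGroup (Fin 2) R

def swapAut (M : Type) [Monoid M] : MulAut (M × M) := MulEquiv.prodComm

lemma swapAut_sq (M : Type) [Monoid M] : swapAut M * swapAut M = 1 :=
  MulEquiv.ext fun _ => rfl

/-- The action of `C₂ = Multiplicative (ZMod 2)` on `M × M` by swapping the factors. -/
def swapHom (M : Type) [Group M] : Multiplicative (ZMod 2) →* MulAut (M × M) :=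
  MonoidHom.mk' (fun c => if c.toAdd = 0 then 1 else swapAut M) (by
    intro a b
    have key : ∀ c : Multiplicative (ZMod 2),
        c = Multiplicative.ofAdd 0 ∨ c = Multiplicative.ofAdd 1 := by decide
    rcases key a with rfl | rfl <;> rcases key b with rfl | rfl <;>
      simp [← ofAdd_add, swapAut_sq] <;> exact fun h => absurd (by decide) h)

end Kac
/-! ### The (base-changed) Kaplansky superalgebra `K₃ ⊗ R` -/

namespace Kac

section Algebras

variable (F : Type) [Field F] (R : Type) [CommRing R] [Algebra F R]

/-- Coordinates: `0 ↦ a`, `1 ↦ u`, `2 ↦ v`. -/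
def K3A (F : Type) [Field F] (R : Type) [CommRing R] [Algebra F R] : Type := Fin 3 → R

instance : AddCommGroup (K3A F R) := Pi.addCommGroup
instance (S : Type) [Semiring S] [Module S R] : Module S (K3A F R) := Pi.module _ _ _

namespace K3A
variable {F R}

def mulFun (x y : K3A F R) : K3A F R := fun i =>
  match i with
  | ⟨0, _⟩ => x 0 * y 0 + (x 1 * y 2 - x 2 * y 1)
  | ⟨1, _⟩ => algebraMap F R 2⁻¹ * (x 0 * y 1 + y 0 * x 1)
  | ⟨2, _⟩ => algebraMap F R 2⁻¹ * (x 0 * y 2 + y 0 * x 2)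

instance : Mul (K3A F R) := ⟨mulFun⟩

lemma mul_def (x y : K3A F R) : x * y = mulFun x y := rfl

@[simp] lemma add_apply (x y : K3A F R) (i : Fin 3) : (x + y) i = x i + y i := rfl
@[simp] lemma sub_apply (x y : K3A F R) (i : Fin 3) : (x - y) i = x i - y i := rfl
@[simp] lemma neg_apply (x : K3A F R) (i : Fin 3) : (-x) i = -(x i) := rfl
@[simp] lemma zero_apply (i : Fin 3) : (0 : K3A F R) i = 0 := rfl
@[simp] lemma smul_apply (S : Type) [Semiring S] [Module S R] (c : S) (x : K3A F R) (i : Fin 3) :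
    (c • x) i = c • (x i) := rfl

variable (F R)

/-- The even part `R·a`. -/
def even (S : Type) [Semiring S] [Module S R] : Submodule S (K3A F R) := stdSub S R 3 {0}
/-- The odd part `W ⊗ R`. -/
def odd (S : Type) [Semiring S] [Module S R] : Submodule S (K3A F R) := stdSub S R 3 {1, 2}

/-- The element `a`. -/
def aE : K3A F R := ![1, 0, 0]
/-- The element of `W ⊗ R` with coordinates `w` in the symplectic basis `{u, v}`. -/
def wE (w : Fin 2 → R) : K3A F R := ![0, w 0, w 1]

end K3A

/-- `J(W) ⊗ R`; coordinates: `0 ↦ 1`, `1 ↦ u`, `2 ↦ v`. -/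
def JW1A (R : Type) [CommRing R] : Type := Fin 3 → R

instance : AddCommGroup (JW1A R) := Pi.addCommGroup
instance (S : Type) [Semiring S] [Module S R] : Module S (JW1A R) := Pi.module _ _ _

namespace JW1A
variable {R}

def mulFun (x y : JW1A R) : JW1A R := fun i =>
  match i with
  | ⟨0, _⟩ => x 0 * y 0 + (x 1 * y 2 - x 2 * y 1)
  | ⟨1, _⟩ => x 0 * y 1 + y 0 * x 1
  | ⟨2, _⟩ => x 0 * y 2 + y 0 * x 2

instance : Mul (JW1A R) := ⟨mulFun⟩

lemma mul_def (x y : JW1A R) : x * y = mulFun x y := rfl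

@[simp] lemma add_apply (x y : JW1A R) (i : Fin 3) : (x + y) i = x i + y i := rfl
@[simp] lemma sub_apply (x y : JW1A R) (i : Fin 3) : (x - y) i = x i - y i := rfl
@[simp] lemma neg_apply (x : JW1A R) (i : Fin 3) : (-x) i = -(x i) := rfl
@[simp] lemma zero_apply (i : Fin 3) : (0 : JW1A R) i = 0 := rfl
@[simp] lemma smul_apply (S : Type) [Semiring S] [Module S R] (c : S) (x : JW1A R) (i : Fin 3) :
    (c • x) i = c • (x i) := rfl

variable (R)

def even (S : Type) [Semiring S] [Module S R] : Submodule S (JW1A R) := stdSub S R 3 {0}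
def odd (S : Type) [Semiring S] [Module S R] : Submodule S (JW1A R) := stdSub S R 3 {1, 2}

def oneE : JW1A R := ![1, 0, 0]
def wE (w : Fin 2 → R) : JW1A R := ![0, w 0, w 1]

end JW1A

/-- `(K₃ × K₃) ⊗ R`; coordinates `0,1,2` for the first copy (`a,u,v`),
`3,4,5` for the second copy. -/
def K33A (F : Type) [Field F] (R : Type) [CommRing R] [Algebra F R] : Type := Fin 6 → R

instance : AddCommGroup (K33A F R) := Pi.addCommGroup
instance (S : Type) [Semiring S] [Module S R] : Module S (K33A F R) := Pi.module _ _ _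

namespace K33A
variable {F R}

def mulFun (x y : K33A F R) : K33A F R := fun i =>
  match i with
  | ⟨0, _⟩ => x 0 * y 0 + (x 1 * y 2 - x 2 * y 1)
  | ⟨1, _⟩ => algebraMap F R 2⁻¹ * (x 0 * y 1 + y 0 * x 1)
  | ⟨2, _⟩ => algebraMap F R 2⁻¹ * (x 0 * y 2 + y 0 * x 2)
  | ⟨3, _⟩ => x 3 * y 3 + (x 4 * y 5 - x 5 * y 4)
  | ⟨4, _⟩ => algebraMap F R 2⁻¹ * (x 3 * y 4 + y 3 * x 4)
  | ⟨5, _⟩ => algebraMap F R 2⁻¹ * (x 3 * y 5 + y 3 * x 5)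

instance : Mul (K33A F R) := ⟨mulFun⟩

lemma mul_def (x y : K33A F R) : x * y = mulFun x y := rfl

@[simp] lemma add_apply (x y : K33A F R) (i : Fin 6) : (x + y) i = x i + y i := rfl
@[simp] lemma sub_apply (x y : K33A F R) (i : Fin 6) : (x - y) i = x i - y i := rfl
@[simp] lemma neg_apply (x : K33A F R) (i : Fin 6) : (-x) i = -(x i) := rfl
@[simp] lemma zero_apply (i : Fin 6) : (0 : K33A F R) i = 0 := rfl
@[simp] lemma smul_apply (S : Type) [Semiring S] [Module S R] (c : S) (x : K33A F R) (i : Fin 6) :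
    (c • x) i = c • (x i) := rfl

variable (F R)

def even (S : Type) [Semiring S] [Module S R] : Submodule S (K33A F R) := stdSub S R 6 {0, 3}
def odd (S : Type) [Semiring S] [Module S R] : Submodule S (K33A F R) := stdSub S R 6 {1, 2, 4, 5}

/-- The element `(a, 0)`. -/
def aLeft : K33A F R := ![1, 0, 0, 0, 0, 0]
/-- The element `(0, a)`. -/
def aRight : K33A F R := ![0, 0, 0, 1, 0, 0]
/-- The element `(v, w)` of the odd part, `v, w ∈ W ⊗ R`. -/
def oddE (w w' : Fin 2 → R) : K33A F R := ![0, w 0, w 1, 0, w' 0, w' 1]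
/-- The exchange automorphism `(x, y) ↦ (y, x)`. -/
def swapFun (x : K33A F R) : K33A F R := fun i =>
  match i with
  | ⟨0, _⟩ => x 3
  | ⟨1, _⟩ => x 4
  | ⟨2, _⟩ => x 5
  | ⟨3, _⟩ => x 0
  | ⟨4, _⟩ => x 1
  | ⟨5, _⟩ => x 2

end K33A

/-- `(J(W) × J(W)) ⊗ R`. -/
def JW2A (R : Type) [CommRing R] : Type := Fin 6 → R

instance : AddCommGroup (JW2A R) := Pi.addCommGroup
instance (S : Type) [Semiring S] [Module S R] : Module S (JW2A R) := Pi.module _ _ _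

namespace JW2A
variable {R}

def mulFun (x y : JW2A R) : JW2A R := fun i =>
  match i with
  | ⟨0, _⟩ => x 0 * y 0 + (x 1 * y 2 - x 2 * y 1)
  | ⟨1, _⟩ => x 0 * y 1 + y 0 * x 1
  | ⟨2, _⟩ => x 0 * y 2 + y 0 * x 2
  | ⟨3, _⟩ => x 3 * y 3 + (x 4 * y 5 - x 5 * y 4)
  | ⟨4, _⟩ => x 3 * y 4 + y 3 * x 4
  | ⟨5, _⟩ => x 3 * y 5 + y 3 * x 5

instance : Mul (JW2A R) := ⟨mulFun⟩

lemma mul_def (x y : JW2A R) : x * y = mulFun x y := rfl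

@[simp] lemma add_apply (x y : JW2A R) (i : Fin 6) : (x + y) i = x i + y i := rfl
@[simp] lemma sub_apply (x y : JW2A R) (i : Fin 6) : (x - y) i = x i - y i := rfl
@[simp] lemma neg_apply (x : JW2A R) (i : Fin 6) : (-x) i = -(x i) := rfl
@[simp] lemma zero_apply (i : Fin 6) : (0 : JW2A R) i = 0 := rfl
@[simp] lemma smul_apply (S : Type) [Semiring S] [Module S R] (c : S) (x : JW2A R) (i : Fin 6) :
    (c • x) i = c • (x i) := rfl

variable (R)

def even (S : Type) [Semiring S] [Module S R] : Submodule S (JW2A R) := stdSub S R 6 {0, 3}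
def odd (S : Type) [Semiring S] [Module S R] : Submodule S (JW2A R) := stdSub S R 6 {1, 2, 4, 5}

/-- The element `(1, 0)`. -/
def oneLeft : JW2A R := ![1, 0, 0, 0, 0, 0]
/-- The element `(0, 1)`. -/
def oneRight : JW2A R := ![0, 0, 0, 1, 0, 0]
def oddE (w w' : Fin 2 → R) : JW2A R := ![0, w 0, w 1, 0, w' 0, w' 1]
def swapFun (x : JW2A R) : JW2A R := fun i =>
  match i with
  | ⟨0, _⟩ => x 3
  | ⟨1, _⟩ => x 4
  | ⟨2, _⟩ => x 5
  | ⟨3, _⟩ => x 0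
  | ⟨4, _⟩ => x 1
  | ⟨5, _⟩ => x 2

end JW2A

/-- Kac's superalgebra `K₁₀ ⊗ R`.  CoordinatesL `0 ↦ 1`, `1 ↦ a⊗a`,
`2 ↦ u⊗u`, `3 ↦ u⊗v`, `4 ↦ v⊗u`, `5 ↦ v⊗v`, `6 ↦ u⊗a`, `7 ↦ v⊗a`,
`8 ↦ a⊗u`, `9 ↦ a⊗v`. -/
def K10A (F : Type) [Field F] (R : Type) [CommRing R] [Algebra F R] : Type := Fin 10 → R

instance : AddCommGroup (K10A F R) := Pi.addCommGroup
instance (S : Type) [Semiring S] [Module S R] : Module S (K10A F R) := Pi.module _ _ _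

namespace K10A
variable {F R}

def mulFun (x y : K10A F R) : K10A F R := fun i =>
  match i with
  | ⟨0, _⟩ => x 0 * y 0 - algebraMap F R (3/16) * (x 1 * y 1)
      + algebraMap F R (3/4) * (x 2 * y 5 + x 5 * y 2 - x 3 * y 4 - x 4 * y 3)
      - algebraMap F R (3/8) * (x 6 * y 7 - x 7 * y 6 + x 8 * y 9 - x 9 * y 8)
  | ⟨1, _⟩ => x 0 * y 1 + x 1 * y 0 + x 1 * y 1
      - (x 2 * y 5 + x 5 * y 2 - x 3 * y 4 - x 4 * y 3)
      + (x 6 * y 7 - x 7 * y 6) + (x 8 * y 9 - x 9 * y 8)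
  | ⟨2, _⟩ => x 0 * y 2 + x 2 * y 0 + algebraMap F R 4⁻¹ * (x 1 * y 2 + x 2 * y 1)
      + algebraMap F R 4⁻¹ * (x 6 * y 8 - x 8 * y 6)
  | ⟨3, _⟩ => x 0 * y 3 + x 3 * y 0 + algebraMap F R 4⁻¹ * (x 1 * y 3 + x 3 * y 1)
      + algebraMap F R 4⁻¹ * (x 6 * y 9 - x 9 * y 6)
  | ⟨4, _⟩ => x 0 * y 4 + x 4 * y 0 + algebraMap F R 4⁻¹ * (x 1 * y 4 + x 4 * y 1)
      + algebraMap F R 4⁻¹ * (x 7 * y 8 - x 8 * y 7)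
  | ⟨5, _⟩ => x 0 * y 5 + x 5 * y 0 + algebraMap F R 4⁻¹ * (x 1 * y 5 + x 5 * y 1)
      + algebraMap F R 4⁻¹ * (x 7 * y 9 - x 9 * y 7)
  | ⟨6, _⟩ => x 0 * y 6 + x 6 * y 0 + algebraMap F R 2⁻¹ * (x 1 * y 6 + x 6 * y 1)
      + algebraMap F R 2⁻¹ * (x 2 * y 9 + x 9 * y 2) - algebraMap F R 2⁻¹ * (x 3 * y 8 + x 8 * y 3)
  | ⟨7, _⟩ => x 0 * y 7 + x 7 * y 0 + algebraMap F R 2⁻¹ * (x 1 * y 7 + x 7 * y 1)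
      + algebraMap F R 2⁻¹ * (x 4 * y 9 + x 9 * y 4) - algebraMap F R 2⁻¹ * (x 5 * y 8 + x 8 * y 5)
  | ⟨8, _⟩ => x 0 * y 8 + x 8 * y 0 + algebraMap F R 2⁻¹ * (x 1 * y 8 + x 8 * y 1)
      - algebraMap F R 2⁻¹ * (x 2 * y 7 + x 7 * y 2) + algebraMap F R 2⁻¹ * (x 4 * y 6 + x 6 * y 4)
  | ⟨9, _⟩ => x 0 * y 9 + x 9 * y 0 + algebraMap F R 2⁻¹ * (x 1 * y 9 + x 9 * y 1)
      - algebraMap F R 2⁻¹ * (x 3 * y 7 + x 7 * y 3) + algebraMap F R 2⁻¹ * (x 5 * y 6 + x 6 * y 5)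

instance : Mul (K10A F R) := ⟨mulFun⟩

lemma mul_def (x y : K10A F R) : x * y = mulFun x y := rfl

@[simp] lemma add_apply (x y : K10A F R) (i : Fin 10) : (x + y) i = x i + y i := rfl
@[simp] lemma sub_apply (x y : K10A F R) (i : Fin 10) : (x - y) i = x i - y i := rfl
@[simp] lemma neg_apply (x : K10A F R) (i : Fin 10) : (-x) i = -(x i) := rfl
@[simp] lemma zero_apply (i : Fin 10) : (0 : K10A F R) i = 0 := rfl
@[simp] lemma smul_apply (S : Type) [Semiring S] [Module S R] (c : S) (x : K10A F R) (i : Fin 10) :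
    (c • x) i = c • (x i) := rfl

variable (F R)

def even (S : Type) [Semiring S] [Module S R] : Submodule S (K10A F R) :=
  stdSub S R 10 {0, 1, 2, 3, 4, 5}
def odd (S : Type) [Semiring S] [Module S R] : Submodule S (K10A F R) :=
  stdSub S R 10 {6, 7, 8, 9}

/-- The unity `1`. -/
def oneE : K10A F R := ![1, 0, 0, 0, 0, 0, 0, 0, 0, 0]
/-- The element `a ⊗ a`. -/
def aaE : K10A F R := ![0, 1, 0, 0, 0, 0, 0, 0, 0, 0]
/-- The element `v ⊗ w ∈ W ⊗ W`. -/
def wwE (w w' : Fin 2 → R) : K10A F R :=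
  ![0, 0, w 0 * w' 0, w 0 * w' 1, w 1 * w' 0, w 1 * w' 1, 0, 0, 0, 0]
/-- The element `w ⊗ a`, `w ∈ W ⊗ R`. -/
def waE (w : Fin 2 → R) : K10A F R := ![0, 0, 0, 0, 0, 0, w 0, w 1, 0, 0]
/-- The element `a ⊗ w`, `w ∈ W ⊗ R`. -/
def awE (w : Fin 2 → R) : K10A F R := ![0, 0, 0, 0, 0, 0, 0, 0, w 0, w 1]
/-- The exchange automorphism `τ`, `τ(x ⊗ y) = (-1)^{|x||y|} y ⊗ x`. -/
def tauFun (x : K10A F R) : K10A F R := fun i =>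
  match i with
  | ⟨0, _⟩ => x 0
  | ⟨1, _⟩ => x 1
  | ⟨2, _⟩ => -x 2
  | ⟨3, _⟩ => -x 4
  | ⟨4, _⟩ => -x 3
  | ⟨5, _⟩ => -x 5
  | ⟨6, _⟩ => x 8
  | ⟨7, _⟩ => x 9
  | ⟨8, _⟩ => x 6
  | ⟨9, _⟩ => x 7

end K10A

end Algebras

end Kac

namespace Kac

section GradingDefs

variable (F : Type) [Field F] {G : Type} [CommGroup G]

/-- Standard basis of `K₃ × K₃` (`a₁, u₁, v₁, a₂, u₂, v₂`). -/
def K33A.bv (i : Fin 6) : K33A F F := Pi.single i 1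

/-- The grading `Γ¹(G; g₁, g₂)` on `K₃ × K₃`: all even elements have degree
`e`, `deg (u,0) = g₁ = deg (v,0)⁻¹`, `deg (0,u) = g₂ = deg (0,v)⁻¹`. -/
def K33A.gamma1 (g1 g2 : G) : G → Submodule F (K33A F F) :=
  gradingOf F (K33A.bv F) ![1, g1, g1⁻¹, 1, g2, g2⁻¹]

/-- The grading `Γ²(G; g, h)` on `K₃ × K₃` (`h² = e ≠ h`):
`deg (a,a) = e`, `deg (a,-a) = h`, `deg (u,u) = g = deg (v,v)⁻¹`,
`deg (u,-u) = gh = deg (v,-v)⁻¹`. -/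
def K33A.gamma2 (g h : G) : G → Submodule F (K33A F F) :=
  gradingOf F
    ![K33A.bv F 0 + K33A.bv F 3, K33A.bv F 0 - K33A.bv F 3,
      K33A.bv F 1 + K33A.bv F 4, K33A.bv F 2 + K33A.bv F 5,
      K33A.bv F 1 - K33A.bv F 4, K33A.bv F 2 - K33A.bv F 5]
    ![1, h, g, g⁻¹, g * h, g⁻¹ * h]

/-- Standard (homogeneous) basis of `K₁₀`:
`1, a⊗a, u⊗u, u⊗v, v⊗u, v⊗v, u⊗a, v⊗a, a⊗u, a⊗v`. -/
def K10A.bv (i : Fin 10) : K10A F F := Pi.single i 1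

/-- The grading `Γ¹_{K₁₀}(G; g₁, g₂)` on `K₁₀`, determined by
`deg (u⊗a) = g₁ = deg (v⊗a)⁻¹`, `deg (a⊗u) = g₂ = deg (a⊗v)⁻¹`. -/
def K10A.gamma1 (g1 g2 : G) : G → Submodule F (K10A F F) :=
  gradingOf F (K10A.bv F)
    ![1, 1, g1 * g2, g1 * g2⁻¹, g1⁻¹ * g2, g1⁻¹ * g2⁻¹, g1, g1⁻¹, g2, g2⁻¹]

/-- The grading `Γ²_{K₁₀}(G; g, h)` on `K₁₀` (`h² = e ≠ h`), determined by
`deg (u⊗a + a⊗u) = g = deg (v⊗a + a⊗v)⁻¹`,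
`deg (u⊗a - a⊗u) = gh = deg (v⊗a - a⊗v)⁻¹`. -/
def K10A.gamma2 (g h : G) : G → Submodule F (K10A F F) :=
  gradingOf F
    ![K10A.bv F 0, K10A.bv F 1, K10A.bv F 3 - K10A.bv F 4,
      K10A.bv F 3 + K10A.bv F 4, K10A.bv F 2, K10A.bv F 5,
      K10A.bv F 6 + K10A.bv F 8, K10A.bv F 7 + K10A.bv F 9,
      K10A.bv F 6 - K10A.bv F 8, K10A.bv F 7 - K10A.bv F 9]
    ![1, 1, 1, h, g * g * h, g⁻¹ * g⁻¹ * h, g, g⁻¹, g * h, g⁻¹ * h]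

end GradingDefs

end Kac

namespace Kac

section Gradings

variable {G S A : Type} [CommRing S] [AddCommGroup A] [Module S A] [Mul A]
  {ev od : Submodule S A}

lemma GradIso.refl (Γ : G → Submodule S A) : GradIso ev od Γ Γ :=
  ⟨1, fun _ => Submodule.map_id _⟩

lemma GradIso.trans {Γ₁ Γ₂ Γ₃ : G → Submodule S A} (h₁₂ : GradIso ev od Γ₁ Γ₂)
    (h₂₃ : GradIso ev od Γ₂ Γ₃) : GradIso ev od Γ₁ Γ₃ := by
  obtain ⟨φ, hφ⟩ := h₁₂
  obtain ⟨ψ, hψ⟩ := h₂₃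
  refine ⟨ψ * φ, fun g => ?_⟩
  rw [← hψ, ← hφ, ← Submodule.map_comp]
  rfl

/-- Isomorphic gradings have the same odd support. -/
lemma GradIso.inf_odd_eq_bot_iff {Γ Δ : G → Submodule S A} (h : GradIso ev od Γ Δ) (g : G) :
    Γ g ⊓ od = ⊥ ↔ Δ g ⊓ od = ⊥ := by
  obtain ⟨φ, hφ⟩ := h
  have hmap : (Γ g ⊓ od).map φ.e.toLinearMap = Δ g ⊓ od := by
    rw [Submodule.map_inf _ φ.e.injective, hφ, φ.map_odd]
  rw [← hmap]
  exact Submodule.map_eq_bot_iff.symm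

/-- An automorphism permuting a homogeneous basis up to sign, compatibly with the degrees,
is an isomorphism of gradings. -/
lemma gradIso_gradingOf_of_perm [CommGroup G] {n : ℕ} {w : Fin n → A} {d d' : Fin n → G}
    (φ : SuperAut S A ev od) (σ : Equiv.Perm (Fin n))
    (hw : ∀ i, φ.e (w i) = w (σ i) ∨ φ.e (w i) = -w (σ i)) (hd : ∀ i, d' (σ i) = d i) :
    GradIso ev od (gradingOf S w d) (gradingOf S w d') := by
  refine ⟨φ, fun g => le_antisymm ?_ ?_⟩
  · rw [gradingOf, Submodule.map_span_le]
    rintro _ ⟨i, hi, rfl⟩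
    have hmem : w (σ i) ∈ gradingOf S w d' g :=
      Submodule.subset_span ⟨σ i, (hd i).trans hi, rfl⟩
    rcases hw i with h | h
    · exact h ▸ hmem
    · exact h ▸ neg_mem hmem
  · refine Submodule.span_le.2 ?_
    rintro _ ⟨j, hj, rfl⟩
    obtain ⟨i, rfl⟩ := σ.surjective j
    have hmem : φ.e (w i) ∈ (gradingOf S w d g).map φ.e.toLinearMap :=
      Submodule.mem_map_of_mem (Submodule.subset_span ⟨i, (hd i).symm.trans hj, rfl⟩)
    rcases hw i with h | h
    · exact h ▸ hmem
    · rw [← neg_neg (w (σ i)), ← h]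
      exact neg_mem hmem

end Gradings

namespace K33A

variable (F : Type) [Field F]

variable {F} in
lemma mem_even {x : K33A F F} : x ∈ even F F F ↔ x 1 = 0 ∧ x 2 = 0 ∧ x 4 = 0 ∧ x 5 = 0 := by
  change (∀ i, i ∉ ({0, 3} : Set (Fin 6)) → x i = 0) ↔ _
  simp [Fin.forall_fin_succ]

variable {F} in
lemma mem_odd {x : K33A F F} : x ∈ odd F F F ↔ x 0 = 0 ∧ x 3 = 0 := by
  change (∀ i, i ∉ ({1, 2, 4, 5} : Set (Fin 6)) → x i = 0) ↔ _
  simp [Fin.forall_fin_succ]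

/-- The exchange automorphism of `K₃ × K₃`. -/
def swapSuperAut : SuperAut F (K33A F F) (even F F F) (odd F F F) where
  e :=
    { toFun := swapFun F F
      invFun := swapFun F F
      left_inv := fun x => by funext i; fin_cases i <;> rfl
      right_inv := fun x => by funext i; fin_cases i <;> rfl
      map_add' := fun x y => by funext i; fin_cases i <;> rfl
      map_smul' := fun c x => by funext i; fin_cases i <;> rfl }
  map_mul' x y := by funext i; fin_cases i <;> rfl
  map_even := by
    rw [Submodule.map_equiv_eq_comap_symm]
    ext x
    change swapFun F F x ∈ even F F F ↔ _
    simp only [mem_even, swapFun]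
    tauto
  map_odd := by
    rw [Submodule.map_equiv_eq_comap_symm]
    ext x
    change swapFun F F x ∈ odd F F F ↔ _
    simp only [mem_odd, swapFun]
    tauto

/-- The automorphism `u ↦ v`, `v ↦ -u` of the first factor, in coordinates. -/
def rotateFun (x : K33A F F) : K33A F F := ![x 0, -x 2, x 1, x 3, x 4, x 5]

/-- The inverse of `rotateFun`. -/
def rotateInvFun (x : K33A F F) : K33A F F := ![x 0, x 2, -x 1, x 3, x 4, x 5]

/-- The automorphism `u ↦ v`, `v ↦ -u` of the first factor. -/
def rotateSuperAut : SuperAut F (K33A F F) (even F F F) (odd F F F) where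
  e :=
    { toFun := rotateFun F
      invFun := rotateInvFun F
      left_inv := fun x => by funext i; fin_cases i <;> simp [rotateFun, rotateInvFun]
      right_inv := fun x => by funext i; fin_cases i <;> simp [rotateFun, rotateInvFun]
      map_add' := fun x y => by
        funext i
        rw [add_apply]
        fin_cases i <;> simp [rotateFun, add_comm]
      map_smul' := fun c x => by
        funext i
        rw [smul_apply]
        fin_cases i <;> simp [rotateFun] }
  map_mul' x y := by
    funext i
    change rotateFun F (mulFun x y) i = mulFun (rotateFun F x) (rotateFun F y) i
    fin_cases i <;> simp [rotateFun, mulFun] <;> ring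
  map_even := by
    rw [Submodule.map_equiv_eq_comap_symm]
    ext x
    change rotateInvFun F x ∈ even F F F ↔ _
    rw [mem_even, mem_even]
    simp [rotateInvFun]
    tauto
  map_odd := by
    rw [Submodule.map_equiv_eq_comap_symm]
    ext x
    change rotateInvFun F x ∈ odd F F F ↔ _
    rw [mem_odd, mem_odd]
    simp [rotateInvFun]

variable {F} {G : Type} [CommGroup G]

lemma bv_apply (i j : Fin 6) : bv F i j = if j = i then 1 else 0 :=
  Pi.single_apply i 1 j

lemma gradIso_gamma1_swap (g₁ g₂ : G) :
    GradIso (even F F F) (odd F F F) (gamma1 F g₁ g₂) (gamma1 F g₂ g₁) := by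
  refine gradIso_gradingOf_of_perm (swapSuperAut F) (Equiv.addRight 3) (fun i => ?_) fun i => ?_
  · left
    funext j
    change swapFun F F (bv F i) j = bv F (i + 3) j
    fin_cases i <;> fin_cases j <;> simp [swapFun, bv_apply]
  · fin_cases i <;> rfl

lemma gradIso_gamma1_inv_left (g₁ g₂ : G) :
    GradIso (even F F F) (odd F F F) (gamma1 F g₁ g₂) (gamma1 F g₁⁻¹ g₂) := by
  refine gradIso_gradingOf_of_perm (rotateSuperAut F) (Equiv.swap 1 2) (fun i => ?_) fun i => ?_
  · change rotateFun F (bv F i) = _ ∨ rotateFun F (bv F i) = _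
    by_cases hi : i = 2
    · right
      subst hi
      funext j
      fin_cases j <;> simp [rotateFun, bv_apply]
    · left
      funext j
      fin_cases i <;> fin_cases j <;>
        simp_all [rotateFun, bv_apply, Equiv.swap_apply_def]
  · fin_cases i <;> simp [Equiv.swap_apply_def]

lemma gradIso_gamma1_of_eq_or_eq_inv {g₁ g₂ h₁ h₂ : G} (h : g₁ = h₁ ∨ g₁ = h₁⁻¹)
    (h' : g₂ = h₂ ∨ g₂ = h₂⁻¹) :
    GradIso (even F F F) (odd F F F) (gamma1 F g₁ g₂) (gamma1 F h₁ h₂) := by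
  have left : ∀ {a b c : G}, a = b ∨ a = b⁻¹ →
      GradIso (even F F F) (odd F F F) (gamma1 F a c) (gamma1 F b c) := by
    rintro a b c (rfl | rfl)
    · exact .refl _
    · simpa using gradIso_gamma1_inv_left (F := F) b⁻¹ c
  exact ((left h).trans (gradIso_gamma1_swap _ _)).trans
    ((left h').trans (gradIso_gamma1_swap _ _))

lemma gamma1_inf_odd_eq_bot_iff (g₁ g₂ g : G) :
    gamma1 F g₁ g₂ g ⊓ odd F F F = ⊥ ↔ g ∉ ({g₁, g₁⁻¹, g₂, g₂⁻¹} : Set G) := by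
  constructor
  · intro hbot hg
    obtain ⟨i, hi, hd⟩ : ∃ i : Fin 6, i ∈ ({1, 2, 4, 5} : Set (Fin 6)) ∧
        (![1, g₁, g₁⁻¹, 1, g₂, g₂⁻¹] : Fin 6 → G) i = g := by
      rcases hg with rfl | rfl | rfl | rfl
      · exact ⟨1, by simp, rfl⟩
      · exact ⟨2, by simp, rfl⟩
      · exact ⟨4, by simp, rfl⟩
      · exact ⟨5, by simp, rfl⟩
    have hmem : bv F i ∈ gamma1 F g₁ g₂ g ⊓ odd F F F := by
      refine ⟨Submodule.subset_span ⟨i, hd, rfl⟩, fun j hj => ?_⟩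
      rw [bv_apply, if_neg]
      rintro rfl
      exact hj hi
    rw [hbot, Submodule.mem_bot] at hmem
    simpa [bv_apply] using congrFun hmem i
  · intro hg
    have hle : gamma1 F g₁ g₂ g ≤ even F F F := by
      refine Submodule.span_le.2 ?_
      rintro _ ⟨i, hi, rfl⟩ j hj
      rw [bv_apply, if_neg]
      rintro rfl
      apply hg
      fin_cases j <;> simp_all
    refine (Submodule.eq_bot_iff _).2 fun x hx => ?_
    funext i
    by_cases hi : i ∈ ({0, 3} : Set (Fin 6))
    · refine hx.2 i ?_
      rcases hi with rfl | rfl <;> simp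
    · exact hle hx.1 i hi

end K33A

end Kac

/-! ### STATEMENT 13 -/

open Kac in
/-- `Γ¹(G; g₁, g₂) ≅ Γ¹(G; g₁', g₂')` on `K₃ × K₃` iff
`{g₁, g₁⁻¹, g₂, g₂⁻¹} = {g₁', g₁'⁻¹, g₂', g₂'⁻¹}`. -/
theorem gamma1_iso_iff (F : Type) [Field F] (hchar : (2 : F) ≠ 0)
    (G : Type) [CommGroup G] (g1 g2 g1' g2' : G) :
    GradIso (K33A.even F F F) (K33A.odd F F F)
        (K33A.gamma1 F g1 g2) (K33A.gamma1 F g1' g2') ↔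
      ({g1, g1⁻¹, g2, g2⁻¹} : Set G) = {g1', g1'⁻¹, g2', g2'⁻¹} := by
  constructor
  · intro h
    ext g
    rw [← not_iff_not, ← K33A.gamma1_inf_odd_eq_bot_iff (F := F),
      ← K33A.gamma1_inf_odd_eq_bot_iff (F := F)]
    exact h.inf_odd_eq_bot_iff g
  · intro h
    have h₁ : g1 ∈ ({g1', g1'⁻¹, g2', g2'⁻¹} : Set G) := h ▸ by simp
    have h₂ : g2 ∈ ({g1', g1'⁻¹, g2', g2'⁻¹} : Set G) := h ▸ by simp
    have h₁' : g1' ∈ ({g1, g1⁻¹, g2, g2⁻¹} : Set G) := h ▸ by simp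
    have h₂' : g2' ∈ ({g1, g1⁻¹, g2, g2⁻¹} : Set G) := h ▸ by simp
    simp only [Set.mem_insert_iff, Set.mem_singleton_iff] at h₁ h₂ h₁' h₂'
    have key : ((g1 = g1' ∨ g1 = g1'⁻¹) ∧ (g2 = g2' ∨ g2 = g2'⁻¹)) ∨
        ((g1 = g2' ∨ g1 = g2'⁻¹) ∧ (g2 = g1' ∨ g2 = g1'⁻¹)) := by
      clear h
      grind [inv_inv]
    rcases key with ⟨h, h'⟩ | ⟨h, h'⟩
    · exact K33A.gradIso_gamma1_of_eq_or_eq_inv h h'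
    · exact (K33A.gradIso_gamma1_of_eq_or_eq_inv h h').trans (K33A.gradIso_gamma1_swap _ _)
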